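/- arXiv:1310.3085 — 3 statements merged into one kernel-verified Lean document; each statement's English description precedes it below -/
import Mathlib

section
/- Let 0 < p < 1 and 0 < D < 1. Set m = 1 - p - D + 2pD, α = (1-p)(1-D)/m and β = p(1-D)/(1-m). Then the capacity of the matched cost-constrained channel evaluated at cost κ = m equals the nonanticipative RDF value, i.e., H(β(1-m) + (1-α)m) - m·H(α) - (1-m)·H(β) = H(m) - H(D), where H is the binary entropy function. -/
open Real

/-- The grouping property of entropy for two positive masses. -/
lemma add_mul_binEntropy_div_add {a b : ℝ} (ha : 0 < a) (hb : 0 < b) :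
    (a + b) * binEntropy (a / (a + b)) = negMulLog a + negMulLog b - negMulLog (a + b) := by
  have hab : a + b ≠ 0 := (add_pos ha hb).ne'
  have h1 : 1 - a / (a + b) = b / (a + b) := by field_simp; ring
  rw [binEntropy_eq_negMulLog_add_negMulLog_one_sub, h1]
  simp only [negMulLog, log_div ha.ne' hab, log_div hb.ne' hab]
  field_simp
  ring

theorem matched_capacity_equals_nonanticipative_RDF
    (p D : ℝ) (hp0 : 0 < p) (hp1 : p < 1) (hD0 : 0 < D) (hD1 : D < 1)
    (m α β : ℝ) (hm : m = 1 - p - D + 2 * p * D)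
    (hα : α = (1 - p) * (1 - D) / m) (hβ : β = p * (1 - D) / (1 - m)) :
    binEntropy (β * (1 - m) + (1 - α) * m) - m * binEntropy α - (1 - m) * binEntropy β
      = binEntropy m - binEntropy D := by
  have hp : 0 < 1 - p := sub_pos.2 hp1
  have hD : 0 < 1 - D := sub_pos.2 hD1
  have hm_eq : m = (1 - p) * (1 - D) + p * D := by rw [hm]; ring
  have hm_compl : 1 - m = p * (1 - D) + (1 - p) * D := by rw [hm]; ring
  have hm0 : m ≠ 0 := by rw [hm_eq]; positivity
  have hm1 : 1 - m ≠ 0 := by rw [hm_compl]; positivity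
  have hout : β * (1 - m) + (1 - α) * m = p := by
    rw [hα, hβ, div_mul_cancel₀ _ hm1, sub_mul, div_mul_cancel₀ _ hm0, hm]
    ring
  have hHα := add_mul_binEntropy_div_add (mul_pos hp hD) (mul_pos hp0 hD0)
  have hHβ := add_mul_binEntropy_div_add (mul_pos hp0 hD) (mul_pos hp hD0)
  rw [← hm_eq, ← hα] at hHα
  rw [← hm_compl, ← hβ] at hHβ
  rw [hout, hHα, hHβ]
  simp only [binEntropy_eq_negMulLog_add_negMulLog_one_sub, negMulLog_mul]
  ring
end

section
/- Let 0 < p < 1 and 0 < D < 1 with m = 1 - p - D + 2pD, α = (1-p)(1-D)/m, β = p(1-D)/(1-m). Define on {0,1}×{0,1} the transition kernel K((x,y),(x',y')) = Q(x,x')·P*(y'|x',y), where Q(x,x') = 1-p if x' = x and p otherwise (the BSMS(p) transition), and P*(y'|x',y) = α if x' = y and y' = x', 1-α if x' = y and y' ≠ x', β if x' ≠ y and y' = x', 1-β if x' ≠ y and y' ≠ x'. Define π on {0,1}×{0,1} by π(x,y) = (1-D)/2 if x = y and D/2 if x ≠ y. Then π is invariant under K: for every (x',y'), the sum over (x,y)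 of π(x,y)·K((x,y),(x',y')) equals π(x',y'). -/
theorem joint_stationary_distribution_invariant
    (p D : ℝ) (hp0 : 0 < p) (hp1 : p < 1) (hD0 : 0 < D) (hD1 : D < 1)
    (m α β : ℝ) (hm : m = 1 - p - D + 2 * p * D)
    (hα : α = (1 - p) * (1 - D) / m) (hβ : β = p * (1 - D) / (1 - m))
    (Q : Bool → Bool → ℝ) (hQ : ∀ x x', Q x x' = if x' = x then 1 - p else p)
    (Pstar : Bool → Bool → Bool → ℝ)
    (hP : ∀ y' x' y, Pstar y' x' y =
      if x' = y then (if y' = x' then α else 1 - α)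
      else (if y' = x' then β else 1 - β))
    (K : Bool × Bool → Bool × Bool → ℝ)
    (hK : ∀ z z', K z z' = Q z.1 z'.1 * Pstar z'.2 z'.1 z.2)
    (π : Bool × Bool → ℝ)
    (hπ : ∀ x y, π (x, y) = if x = y then (1 - D) / 2 else D / 2) :
    ∀ z' : Bool × Bool, (∑ z : Bool × Bool, π z * K z z') = π z' := by
  have hm_pos : 0 < m := by
    nlinarith [mul_pos (sub_pos.2 hp1) (sub_pos.2 hD1), mul_pos hp0 hD0]
  have hm_lt : 0 < 1 - m := by
    nlinarith [mul_pos hp0 (sub_pos.2 hD1), mul_pos (sub_pos.2 hp1) hD0]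
  have hmα : m * α = (1 - p) * (1 - D) := by
    rw [hα]
    field_simp
  have hmβ : (1 - m) * β = p * (1 - D) := by
    rw [hβ]
    field_simp
  clear hα hβ
  subst hm
  rintro ⟨x', y'⟩
  cases x' <;> cases y' <;>
    simp only [Fintype.sum_prod_type, Fintype.sum_bool, hK, hπ, hQ, hP, reduceCtorEq, if_true,
      if_false] <;>
    first
    | linear_combination (hmα + hmβ) / 2
    | linear_combination -(hmα + hmβ) / 2
end

section
/- Let 0 < p < 1 and 0 < D < 1 with m = 1 - p - D + 2pD, α = (1-p)(1-D)/m, β = p(1-D)/(1-m). Let Q(x,x') = 1-p if x' = x and p otherwise, let P*(y'|x',y) = α if x' = y and y' = x', 1-α if x' = y and y' ≠ x', β if x' ≠ y and y' = x', 1-β if x' ≠ y and y' ≠ x', and let π(x,y) = (1-D)/2 if x = y and D/2 otherwise. Then the stationary probability that the next reproduction symbol equals the previous one, namely the sum over (x,y,x') of π(x,y)·Q(x,x')·P*(y|x',y), equals 1 - p; i.e., the reproduction process of the optimal realization is itself a binary symmetric Markov source with parameter p. -/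
theorem reproduction_process_is_BSMS_p
    (p D : ℝ) (hp0 : 0 < p) (hp1 : p < 1) (hD0 : 0 < D) (hD1 : D < 1)
    (m α β : ℝ) (hm : m = 1 - p - D + 2 * p * D)
    (hα : α = (1 - p) * (1 - D) / m) (hβ : β = p * (1 - D) / (1 - m))
    (Q : Bool → Bool → ℝ) (hQ : ∀ x x', Q x x' = if x' = x then 1 - p else p)
    (Pstar : Bool → Bool → Bool → ℝ)
    (hP : ∀ y' x' y, Pstar y' x' y =
      if x' = y then (if y' = x' then α else 1 - α)
      else (if y' = x' then β else 1 - β))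
    (π : Bool × Bool → ℝ)
    (hπ : ∀ x y, π (x, y) = if x = y then (1 - D) / 2 else D / 2) :
    (∑ z : Bool × Bool, ∑ x' : Bool, π z * Q z.1 x' * Pstar z.2 x' z.2) = 1 - p := by
  have hm_pos : 0 < m := by
    nlinarith [mul_pos hp0 hD0, mul_pos (sub_pos.2 hp1) (sub_pos.2 hD1)]
  have hm_lt : 0 < 1 - m := by
    nlinarith [mul_pos hp0 (sub_pos.2 hD1), mul_pos (sub_pos.2 hp1) hD0]
  have hαm : α * m = (1 - p) * (1 - D) := by
    rw [hα, div_mul_cancel₀ _ hm_pos.ne']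
  have hβm : β * (1 - m) = p * (1 - D) := by
    rw [hβ, div_mul_cancel₀ _ hm_lt.ne']
  clear hα hβ
  subst hm
  simp only [Fintype.sum_prod_type, Fintype.sum_bool, hQ, hP, hπ]
  simp only [reduceCtorEq, if_true, if_false]
  linear_combination hαm - hβm
end
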